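/- (Zero curvature is equivalent to the Hodge system.) Let W_ρ, W_z : ℝ²₊ → ℂ^{n×n} be C¹, and define Ω_ρ(λ,x) = a W_ρ(x) − bρ W_z(x) and Ω_z(λ,x) = a W_z(x) + bρ W_ρ(x), where a(λ,x)=ρ²/(λ²+ρ²) and b(λ,x)=λ/(λ²+ρ²). Fix x ∈ ℝ²₊. Then the zero-curvature equation D_ρΩ_z − D_zΩ_ρ + Ω_ρΩ_z − Ω_zΩ_ρ = 0 holds at (λ,x) for every λ ∈ ℂ with λ ≠ 0 and λ²+ρ² ≠ 0 if and only if at x both equations of the Hodge system hold: ∂_ρW_z − ∂_zW_ρ + W_ρW_z − W_zW_ρ = 0 (i.e. dW + W∧W = 0) and ∂_ρ(ρW_ρ) + ∂_z(ρW_z) = 0 (i.e. d(ρ*W) = 0). -/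

import Mathlib

open Matrix

attribute [local instance] Matrix.normedAddCommGroup Matrix.normedSpace

/-- The function `ω_ρ(λ, x) = -2ρλ/(λ² + ρ²)` on `ℂ × ℝ²`. -/
noncomputable def omegaRho (p : ℂ × ℝ × ℝ) : ℂ :=
  -2 * (p.2.1 : ℂ) * p.1 / (p.1 ^ 2 + (p.2.1 : ℂ) ^ 2)

/-- The function `ω_z(λ, x) = -2λ²/(λ² + ρ²)` on `ℂ × ℝ²`. -/
noncomputable def omegaZ (p : ℂ × ℝ × ℝ) : ℂ :=
  -2 * p.1 ^ 2 / (p.1 ^ 2 + (p.2.1 : ℂ) ^ 2)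

/-- The operator `D_ρ f = ∂_ρ f − ω_ρ ∂_λ f`. -/
noncomputable def Drho {E : Type*} [NormedAddCommGroup E] [NormedSpace ℂ E]
    (f : ℂ × ℝ × ℝ → E) (p : ℂ × ℝ × ℝ) : E :=
  fderiv ℝ f p ((0 : ℂ), (1 : ℝ), (0 : ℝ)) -
    omegaRho p • fderiv ℝ f p ((1 : ℂ), (0 : ℝ), (0 : ℝ))

/-- The operator `D_z f = ∂_z f − ω_z ∂_λ f`. -/
noncomputable def Dzop {E : Type*} [NormedAddCommGroup E] [NormedSpace ℂ E]
    (f : ℂ × ℝ × ℝ → E) (p : ℂ × ℝ × ℝ) : E :=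
  fderiv ℝ f p ((0 : ℂ), (0 : ℝ), (1 : ℝ)) -
    omegaZ p • fderiv ℝ f p ((1 : ℂ), (0 : ℝ), (0 : ℝ))

/-- `a(λ, x) = ρ²/(λ² + ρ²)`. -/
noncomputable def aF (p : ℂ × ℝ × ℝ) : ℂ :=
  (p.2.1 : ℂ) ^ 2 / (p.1 ^ 2 + (p.2.1 : ℂ) ^ 2)

/-- `b(λ, x) = λ/(λ² + ρ²)`. -/
noncomputable def bF (p : ℂ × ℝ × ℝ) : ℂ :=
  p.1 / (p.1 ^ 2 + (p.2.1 : ℂ) ^ 2)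

/-- The denominator `λ² + ρ²` has real derivative `2λ dλ + 2ρ dρ`. -/
lemma hasFDerivAt_sq_add_sq (p : ℂ × ℝ × ℝ) :
    ∃ L : ℂ × ℝ × ℝ →L[ℝ] ℂ,
      HasFDerivAt (fun q : ℂ × ℝ × ℝ => q.1 ^ 2 + (q.2.1 : ℂ) ^ 2) L p ∧
        ∀ v, L v = 2 * p.1 * v.1 + 2 * (p.2.1 : ℂ) * (v.2.1 : ℂ) := by
  have h1 : HasFDerivAt (fun q : ℂ × ℝ × ℝ => q.1) (ContinuousLinearMap.fst ℝ ℂ (ℝ × ℝ)) p :=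
    hasFDerivAt_fst
  have h2 : HasFDerivAt (fun q : ℂ × ℝ × ℝ => (q.2.1 : ℂ)) _ p :=
    (Complex.ofRealCLM ∘L ContinuousLinearMap.fst ℝ ℝ ℝ ∘L
      ContinuousLinearMap.snd ℝ ℂ (ℝ × ℝ)).hasFDerivAt
  refine ⟨_, (h1.pow 2).add (h2.pow 2), fun v => ?_⟩
  simp

lemma hasFDerivAt_aF (p : ℂ × ℝ × ℝ) (hs : p.1 ^ 2 + (p.2.1 : ℂ) ^ 2 ≠ 0) :
    ∃ L : ℂ × ℝ × ℝ →L[ℝ] ℂ, HasFDerivAt aF L p ∧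
      ∀ v, L v = 2 * p.1 * (p.2.1 : ℂ) * (p.1 * (v.2.1 : ℂ) - (p.2.1 : ℂ) * v.1) /
        (p.1 ^ 2 + (p.2.1 : ℂ) ^ 2) ^ 2 := by
  have h2 : HasFDerivAt (fun q : ℂ × ℝ × ℝ => (q.2.1 : ℂ)) _ p :=
    (Complex.ofRealCLM ∘L ContinuousLinearMap.fst ℝ ℝ ℝ ∘L
      ContinuousLinearMap.snd ℝ ℂ (ℝ × ℝ)).hasFDerivAt
  obtain ⟨L, hL, hLv⟩ := hasFDerivAt_sq_add_sq p
  refine ⟨_, (h2.pow 2).mul ((hasFDerivAt_inv' (𝕜 := ℝ) hs).comp p hL), fun v => ?_⟩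
  simp [hLv]
  field_simp
  ring

lemma hasFDerivAt_bF_mul (p : ℂ × ℝ × ℝ) (hs : p.1 ^ 2 + (p.2.1 : ℂ) ^ 2 ≠ 0) :
    ∃ L : ℂ × ℝ × ℝ →L[ℝ] ℂ, HasFDerivAt (fun q => bF q * (q.2.1 : ℂ)) L p ∧
      ∀ v, L v = (p.1 ^ 2 - (p.2.1 : ℂ) ^ 2) * (p.1 * (v.2.1 : ℂ) - (p.2.1 : ℂ) * v.1) /
        (p.1 ^ 2 + (p.2.1 : ℂ) ^ 2) ^ 2 := by
  have h1 : HasFDerivAt (fun q : ℂ × ℝ × ℝ => q.1) (ContinuousLinearMap.fst ℝ ℂ (ℝ × ℝ)) p :=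
    hasFDerivAt_fst
  have h2 : HasFDerivAt (fun q : ℂ × ℝ × ℝ => (q.2.1 : ℂ)) _ p :=
    (Complex.ofRealCLM ∘L ContinuousLinearMap.fst ℝ ℝ ℝ ∘L
      ContinuousLinearMap.snd ℝ ℂ (ℝ × ℝ)).hasFDerivAt
  obtain ⟨L, hL, hLv⟩ := hasFDerivAt_sq_add_sq p
  refine ⟨_, (h1.mul ((hasFDerivAt_inv' (𝕜 := ℝ) hs).comp p hL)).mul h2, fun v => ?_⟩
  simp [hLv]
  field_simp
  ring

/-- Directional derivative of a combination `α A + β B` with scalar coefficients depending on all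
variables and vectors depending on `x = (ρ, z)` only. -/
lemma fderiv_smul_add_smul {E : Type*} [NormedAddCommGroup E] [NormedSpace ℂ E]
    {α β : ℂ × ℝ × ℝ → ℂ} {A B : ℝ × ℝ → E} {p : ℂ × ℝ × ℝ} {α' β' : ℂ × ℝ × ℝ →L[ℝ] ℂ}
    (hα : HasFDerivAt α α' p) (hβ : HasFDerivAt β β' p)
    (hA : DifferentiableAt ℝ A p.2) (hB : DifferentiableAt ℝ B p.2) (v : ℂ × ℝ × ℝ) :
    fderiv ℝ (fun q : ℂ × ℝ × ℝ => α q • A q.2 + β q • B q.2) p v =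
      α p • fderiv ℝ A p.2 v.2 + α' v • A p.2 + (β p • fderiv ℝ B p.2 v.2 + β' v • B p.2) := by
  have hA' : HasFDerivAt (fun q : ℂ × ℝ × ℝ => A q.2)
      (fderiv ℝ A p.2 ∘L ContinuousLinearMap.snd ℝ ℂ (ℝ × ℝ)) p :=
    hA.hasFDerivAt.comp p hasFDerivAt_snd
  have hB' : HasFDerivAt (fun q : ℂ × ℝ × ℝ => B q.2)
      (fderiv ℝ B p.2 ∘L ContinuousLinearMap.snd ℝ ℂ (ℝ × ℝ)) p :=
    hB.hasFDerivAt.comp p hasFDerivAt_snd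
  rw [((hα.fun_smul hA').fun_add (hβ.fun_smul hB')).fderiv]
  simp

lemma fderiv_ofReal_fst_smul {E : Type*} [NormedAddCommGroup E] [NormedSpace ℂ E]
    {A : ℝ × ℝ → E} {x : ℝ × ℝ} (hA : DifferentiableAt ℝ A x) (v : ℝ × ℝ) :
    fderiv ℝ (fun y : ℝ × ℝ => (y.1 : ℂ) • A y) x v =
      (x.1 : ℂ) • fderiv ℝ A x v + (v.1 : ℂ) • A x := by
  have h : HasFDerivAt (fun y : ℝ × ℝ => (y.1 : ℂ)) _ x :=
    (Complex.ofRealCLM ∘L ContinuousLinearMap.fst ℝ ℝ ℝ).hasFDerivAt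
  rw [(h.fun_smul hA.hasFDerivAt).fderiv]
  simp

/-- The linear part of the curvature of `Ω_ρ = aA − bρB`, `Ω_z = aB + bρA`, sorted by powers
of the spectral parameter. -/
lemma Drho_sub_Dzop_eq {E : Type*} [NormedAddCommGroup E] [NormedSpace ℂ E]
    {A B : ℝ × ℝ → E} {p : ℂ × ℝ × ℝ} (hs : p.1 ^ 2 + (p.2.1 : ℂ) ^ 2 ≠ 0)
    (hA : DifferentiableAt ℝ A p.2) (hB : DifferentiableAt ℝ B p.2) :
    Drho (fun q => aF q • B q.2 + (bF q * (q.2.1 : ℂ)) • A q.2) p -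
        Dzop (fun q => aF q • A q.2 - (bF q * (q.2.1 : ℂ)) • B q.2) p =
      aF p • (fderiv ℝ B p.2 (1, 0) - fderiv ℝ A p.2 (0, 1)) +
        bF p • ((p.2.1 : ℂ) • fderiv ℝ A p.2 (1, 0) + A p.2 +
          (p.2.1 : ℂ) • fderiv ℝ B p.2 (0, 1)) := by
  obtain ⟨a', ha, ha'⟩ := hasFDerivAt_aF p hs
  obtain ⟨c', hc, hc'⟩ := hasFDerivAt_bF_mul p hs
  have e : (fun q : ℂ × ℝ × ℝ => aF q • A q.2 - (bF q * (q.2.1 : ℂ)) • B q.2) =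
      fun q => aF q • A q.2 + (-(bF q * (q.2.1 : ℂ))) • B q.2 := by
    funext q; rw [neg_smul, sub_eq_add_neg]
  have hA0 : fderiv ℝ A p.2 ((0 : ℝ), (0 : ℝ)) = 0 := (fderiv ℝ A p.2).map_zero
  have hB0 : fderiv ℝ B p.2 ((0 : ℝ), (0 : ℝ)) = 0 := (fderiv ℝ B p.2).map_zero
  rw [Drho, Dzop, e]
  simp only [fderiv_smul_add_smul ha hc hB hA, fderiv_smul_add_smul ha hc.fun_neg hA hB,
    _root_.neg_apply, ha', hc', hA0, hB0]
  simp only [aF, bF, omegaRho, omegaZ, Complex.ofReal_zero, Complex.ofReal_one]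
  match_scalars <;> field_simp <;> ring

/-- The commutator part of the curvature. -/
lemma commutator_aF_bF {R : Type*} [Ring R] [Algebra ℂ R] (A B : R) {p : ℂ × ℝ × ℝ}
    (hs : p.1 ^ 2 + (p.2.1 : ℂ) ^ 2 ≠ 0) :
    (aF p • A - (bF p * (p.2.1 : ℂ)) • B) * (aF p • B + (bF p * (p.2.1 : ℂ)) • A) -
        (aF p • B + (bF p * (p.2.1 : ℂ)) • A) * (aF p • A - (bF p * (p.2.1 : ℂ)) • B) =
      aF p • (A * B - B * A) := by
  have h : aF p = aF p * aF p + (bF p * (p.2.1 : ℂ)) * (bF p * (p.2.1 : ℂ)) := by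
    simp only [aF, bF]; field_simp; ring
  conv_rhs => rw [h]
  simp only [sub_mul, mul_sub, add_mul, mul_add, smul_mul_smul_comm]
  module

/-- A combination `a X + b Y` vanishes for all admissible spectral parameters iff `X = Y = 0`. -/
lemma forall_aF_smul_add_bF_smul_eq_zero_iff {E : Type*} [AddCommGroup E] [Module ℂ E]
    {x : ℝ × ℝ} (hx : 0 < x.1) (X Y : E) :
    (∀ l : ℂ, l ≠ 0 → l ^ 2 + (x.1 : ℂ) ^ 2 ≠ 0 → aF (l, x) • X + bF (l, x) • Y = 0) ↔
      X = 0 ∧ Y = 0 := by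
  refine ⟨fun h => ?_, fun ⟨hX, hY⟩ l _ _ => by simp [hX, hY]⟩
  have hr : (x.1 : ℂ) ≠ 0 := by exact_mod_cast hx.ne'
  have h1 := h (x.1 : ℂ) hr (by rw [← two_mul]; simp [hr])
  have h2 := h (-(x.1 : ℂ)) (neg_ne_zero.2 hr) (by rw [neg_sq, ← two_mul]; simp [hr])
  have a1 : aF ((x.1 : ℂ), x) = 1 / 2 := by simp only [aF]; field_simp; norm_num
  have a2 : aF (-(x.1 : ℂ), x) = 1 / 2 := by simp only [aF]; field_simp; norm_num
  have b2 : bF (-(x.1 : ℂ), x) = -bF ((x.1 : ℂ), x) := by simp [bF, neg_div]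
  rw [a1] at h1
  rw [a2, b2] at h2
  have hX : X = 0 := by linear_combination (norm := module) h1 + h2
  have hb : bF ((x.1 : ℂ), x) ≠ 0 := by
    simp only [bF]; exact div_ne_zero hr (by rw [← two_mul]; simp [hr])
  refine ⟨hX, ?_⟩
  rw [hX, smul_zero, zero_add] at h1
  exact (smul_eq_zero.1 h1).resolve_left hb

/-- with `Ω_ρ = aW_ρ − bρW_z`, `Ω_z = aW_z + bρW_ρ`, the zero-curvature
equation holds at `(λ, x)` for every admissible `λ` if and only if the Hodge system
`dW + W∧W = 0`, `d(ρ*W) = 0` holds at `x`. -/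
theorem statement5 (n : ℕ) (hn : 1 ≤ n)
    (Wρ Wz : ℝ × ℝ → Matrix (Fin n) (Fin n) ℂ)
    (hWρ : ContDiffOn ℝ 1 Wρ {x : ℝ × ℝ | 0 < x.1})
    (hWz : ContDiffOn ℝ 1 Wz {x : ℝ × ℝ | 0 < x.1})
    (Ωρ Ωz : ℂ × ℝ × ℝ → Matrix (Fin n) (Fin n) ℂ)
    (hΩρ : ∀ p : ℂ × ℝ × ℝ, Ωρ p = aF p • Wρ p.2 - (bF p * (p.2.1 : ℂ)) • Wz p.2)
    (hΩz : ∀ p : ℂ × ℝ × ℝ, Ωz p = aF p • Wz p.2 + (bF p * (p.2.1 : ℂ)) • Wρ p.2)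
    (x : ℝ × ℝ) (hx : 0 < x.1) :
    (∀ l : ℂ, l ≠ 0 → l ^ 2 + (x.1 : ℂ) ^ 2 ≠ 0 →
        Drho Ωz (l, x) - Dzop Ωρ (l, x) + Ωρ (l, x) * Ωz (l, x) - Ωz (l, x) * Ωρ (l, x) = 0)
      ↔
    (fderiv ℝ Wz x ((1 : ℝ), (0 : ℝ)) - fderiv ℝ Wρ x ((0 : ℝ), (1 : ℝ)) +
        Wρ x * Wz x - Wz x * Wρ x = 0 ∧
      fderiv ℝ (fun y : ℝ × ℝ => (y.1 : ℂ) • Wρ y) x ((1 : ℝ), (0 : ℝ)) +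
        fderiv ℝ (fun y : ℝ × ℝ => (y.1 : ℂ) • Wz y) x ((0 : ℝ), (1 : ℝ)) = 0) := by
  obtain rfl : Ωρ = fun p => aF p • Wρ p.2 - (bF p * (p.2.1 : ℂ)) • Wz p.2 := funext hΩρ
  obtain rfl : Ωz = fun p => aF p • Wz p.2 + (bF p * (p.2.1 : ℂ)) • Wρ p.2 := funext hΩz
  have hU : {x : ℝ × ℝ | 0 < x.1} ∈ nhds x :=
    (isOpen_lt continuous_const continuous_fst).mem_nhds hx
  have hA : DifferentiableAt ℝ Wρ x := (hWρ.contDiffAt hU).differentiableAt one_ne_zero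
  have hB : DifferentiableAt ℝ Wz x := (hWz.contDiffAt hU).differentiableAt one_ne_zero
  have key := forall_aF_smul_add_bF_smul_eq_zero_iff hx
    (fderiv ℝ Wz x (1, 0) - fderiv ℝ Wρ x (0, 1) + (Wρ x * Wz x - Wz x * Wρ x))
    ((x.1 : ℂ) • fderiv ℝ Wρ x (1, 0) + Wρ x + (x.1 : ℂ) • fderiv ℝ Wz x (0, 1))
  have hA' : fderiv ℝ (fun y : ℝ × ℝ => (y.1 : ℂ) • Wρ y) x ((1 : ℝ), (0 : ℝ)) = _ :=
    fderiv_ofReal_fst_smul hA _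
  have hB' : fderiv ℝ (fun y : ℝ × ℝ => (y.1 : ℂ) • Wz y) x ((0 : ℝ), (1 : ℝ)) = _ :=
    fderiv_ofReal_fst_smul hB _
  rw [hA', hB']
  simp only [Complex.ofReal_one, Complex.ofReal_zero, one_smul, zero_smul, add_zero]
  rw [add_sub_assoc]
  refine Iff.trans ?_ key
  refine forall_congr' fun l => imp_congr_right fun _ => imp_congr_right fun hs => ?_
  have hD := Drho_sub_Dzop_eq (p := (l, x)) hs hA hB
  have hC := commutator_aF_bF (Wρ x) (Wz x) (p := (l, x)) hs
  rw [add_sub_assoc, hD, hC, add_right_comm, ← smul_add]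
  exact Iff.rfl
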